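/- Let G be a finite simple graph with vertex set V. For v ∈ V and X ⊆ V, let d_X(v) be the number of neighbors of v lying in X, and let K := max over nonempty X ⊆ V of ρ((d_X(v))_{v∈V}). Then M(G) ≤ λmax(G) ≤ √(2·(log K + 1)·(log|V| + 4))·M(G). -/

import Mathlib

-- `lamMax G`: the largest eigenvalue of the adjacency matrix of `G`.
open Classical in
noncomputable def lamMax {V : Type*} [Fintype V] (G : SimpleGraph V) : ℝ :=
  sSup (spectrum ℝ (G.adjMatrix ℝ))

-- `eXY G X Y = e(X,Y)`: the number of ordered pairs `(x,y) ∈ X × Y` with `x` adjacent to `y`.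
open Classical in
noncomputable def eXY {V : Type*} (G : SimpleGraph V) (X Y : Finset V) : ℕ :=
  ((X ×ˢ Y).filter fun p => G.Adj p.1 p.2).card

/-- `M(G)`: the maximum of `e(X,Y)/√(|X||Y|)` over nonempty `X, Y ⊆ V`. -/
noncomputable def MG {V : Type*} (G : SimpleGraph V) : ℝ :=
  sSup {r : ℝ | ∃ X Y : Finset V, X.Nonempty ∧ Y.Nonempty ∧
    r = (eXY G X Y : ℝ) / Real.sqrt ((X.card : ℝ) * (Y.card : ℝ))}

-- `rho d = ρ(d)` for a finite sequence `d` with non-negative terms: with `d₁ ≥ … ≥ dₙ`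
-- the non-increasing rearrangement of `d` and `k` the smallest index (1-based) with
-- `d₁² + … + d_k² ≥ d_{k+1}² + … + dₙ²`, `ρ(d) = d₁ / d_k` if `d_k ≠ 0`, else `ρ(d) = 1`.
open Classical in
noncomputable def rho {n : ℕ} (d : Fin n → ℝ) : ℝ :=
  if hn : 0 < n then
    -- `s` is the non-increasing rearrangement of `d`
    let s : Fin n → ℝ := fun i => d (Tuple.sort d i.rev)
    -- `k` is the smallest (0-based) index with `s 0 ^ 2 + … + s k ^ 2 ≥` the remaining sum
    let k : Fin n := ⟨min (sInf {k : ℕ |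
        ∑ i : Fin n, (if k < (i : ℕ) then s i ^ 2 else 0) ≤
        ∑ i : Fin n, (if (i : ℕ) ≤ k then s i ^ 2 else 0)}) (n - 1),
      lt_of_le_of_lt (min_le_right _ _) (Nat.sub_lt hn one_pos)⟩
    if s k ≠ 0 then s ⟨0, hn⟩ / s k else 1
  else 1

/-- A finite sequence, extended by zero to the natural numbers. -/
def extendByZero {n : ℕ} {E : Type*} [Zero E] (b : Fin n → E) (i : ℕ) : E :=
  if h : i < n then b ⟨i, h⟩ else 0

theorem extendByZero_of_lt {n : ℕ} {E : Type*} [Zero E] (b : Fin n → E) {i : ℕ} (h : i < n) :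
    extendByZero b i = b ⟨i, h⟩ := dif_pos h

theorem extendByZero_of_le {n : ℕ} {E : Type*} [Zero E] (b : Fin n → E) {i : ℕ} (h : n ≤ i) :
    extendByZero b i = 0 := dif_neg (not_lt.mpr h)

theorem extendByZero_nonneg {n : ℕ} {b : Fin n → ℝ} (hb : ∀ i, 0 ≤ b i) (i : ℕ) :
    0 ≤ extendByZero b i := by
  unfold extendByZero
  split_ifs
  exacts [hb _, le_rfl]

theorem antitone_extendByZero {n : ℕ} {b : Fin n → ℝ} (hb : ∀ i, 0 ≤ b i) (ha : Antitone b) :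
    Antitone (extendByZero b) := by
  intro i j hij
  by_cases hj : j < n
  · rw [extendByZero_of_lt b hj, extendByZero_of_lt b (hij.trans_lt hj)]
    exact ha hij
  · rw [extendByZero_of_le b (not_lt.mp hj)]
    exact extendByZero_nonneg hb i

theorem exists_finset_sum_range_extendByZero {n m : ℕ} (hm : m ≤ n) {ι : Type*}
    (σ : Fin n ≃ ι) : ∃ Y : Finset ι, Y.card = m ∧
      ∀ {E : Type*} [AddCommMonoid E] (b : ι → E),
        ∑ i ∈ Finset.range m, extendByZero (b ∘ σ) i = ∑ x ∈ Y, b x := by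
  refine ⟨(Finset.univ.map (Fin.castLEEmb hm)).map σ.toEmbedding, by simp, ?_⟩
  intro E _ b
  rw [Finset.sum_range, Finset.sum_map, Finset.sum_map]
  refine Finset.sum_congr rfl fun i _ => ?_
  rw [extendByZero_of_lt _ (i.2.trans_le hm)]
  rfl

/-- The permutation putting a finite sequence in non-increasing order. -/
noncomputable def sortDesc {n : ℕ} (d : Fin n → ℝ) : Equiv.Perm (Fin n) :=
  Fin.revPerm.trans (Tuple.sort d)

theorem antitone_comp_sortDesc {n : ℕ} (d : Fin n → ℝ) : Antitone (d ∘ sortDesc d) := by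
  intro i j hij
  exact Tuple.monotone_sort d (Fin.rev_le_rev.mpr hij)

theorem sum_sq_le_of_prefix_sum_le {f : ℕ → ℝ} (hf : Antitone f) {C : ℝ} {n k : ℕ}
    (hS : ∀ m ≤ n, ∑ i ∈ Finset.range m, f i ≤ C * √m) (hk : k < n) (hpos : 0 < f k) :
    ∑ i ∈ Finset.range (k + 1), f i ^ 2 ≤ C ^ 2 * (Real.log (f 0 / f k) + 1) := by
  have hS0 : ∀ j, j < n → 0 < f j →
      (∑ i ∈ Finset.range (j + 1), f i) * f j ≤ C ^ 2 := by
    intro j hj hfj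
    have h1 := hS (j + 1) hj
    have h2 : ((j + 1 : ℕ) : ℝ) * f j ≤ ∑ i ∈ Finset.range (j + 1), f i := by
      have := Finset.card_nsmul_le_sum (Finset.range (j + 1)) f (f j)
        (fun i hi => hf (Nat.lt_succ_iff.mp (Finset.mem_range.mp hi)))
      simpa using this
    set r : ℝ := √((j + 1 : ℕ) : ℝ) with hr
    have hr0 : 0 < r := Real.sqrt_pos.mpr (by positivity)
    have hrr : r * r = ((j + 1 : ℕ) : ℝ) := Real.mul_self_sqrt (by positivity)
    have h3 : r * f j ≤ C := by
      rw [← hrr] at h2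
      have : r * (r * f j) ≤ r * C := by linarith
      exact le_of_mul_le_mul_left this hr0
    have h4 : 0 ≤ r * f j := by positivity
    calc (∑ i ∈ Finset.range (j + 1), f i) * f j ≤ (C * r) * f j := by gcongr
      _ = C * (r * f j) := by ring
      _ ≤ C * C := by gcongr; linarith
      _ = C ^ 2 := by ring
  have key : ∀ j, j ≤ k → ∑ i ∈ Finset.range (j + 1), f i ^ 2
      - (∑ i ∈ Finset.range (j + 1), f i) * f j ≤ C ^ 2 * Real.log (f 0 / f j) := by
    intro j
    induction j with
    | zero =>
      intro _
      have h0 : f 0 ≠ 0 := (hpos.trans_le (hf (Nat.zero_le k))).ne'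
      simp [h0, sq]
    | succ j ih =>
      intro hj
      have ih := ih (by omega)
      have p1 : 0 < f (j + 1) := hpos.trans_le (hf hj)
      have p0 : 0 < f j := hpos.trans_le (hf (by omega))
      have pp : 0 < f 0 := hpos.trans_le (hf (by omega))
      have hlog : Real.log (f 0 / f (j + 1)) =
          Real.log (f 0 / f j) - Real.log (f (j + 1) / f j) := by
        rw [Real.log_div pp.ne' p1.ne', Real.log_div pp.ne' p0.ne', Real.log_div p1.ne' p0.ne']
        ring
      have hl := Real.log_le_sub_one_of_pos (div_pos p1 p0)
      have hs := hS0 j (by omega) p0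
      have hd : 0 ≤ 1 - f (j + 1) / f j := by
        rw [sub_nonneg, div_le_one p0]
        exact hf (Nat.le_succ j)
      have h5 : (∑ i ∈ Finset.range (j + 1), f i) * (f j - f (j + 1)) ≤
          C ^ 2 * (1 - f (j + 1) / f j) := by
        calc _ = ((∑ i ∈ Finset.range (j + 1), f i) * f j) * (1 - f (j + 1) / f j) := by
              field_simp
          _ ≤ _ := by gcongr
      have h6 : C ^ 2 * (1 - f (j + 1) / f j) ≤ C ^ 2 * (- Real.log (f (j + 1) / f j)) := by
        gcongr
        linarith
      rw [hlog, Finset.sum_range_succ _ (j + 1), Finset.sum_range_succ f (j + 1)]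
      linarith
  have h1 := key k le_rfl
  have h2 := hS0 k hk hpos
  linarith

theorem norm_sum_smul_le_of_prefix {E : Type*} [NormedAddCommGroup E] [NormedSpace ℝ E]
    {g : ℕ → ℝ} (hg : Antitone g) {c : ℕ → E} {D : ℝ} {n : ℕ}
    (hP : ∀ m ≤ n, ‖∑ i ∈ Finset.range m, c i‖ ≤ D * √m) (hgn : g n = 0) :
    ‖∑ i ∈ Finset.range n, g i • c i‖ ≤
      D * ∑ i ∈ Finset.range n, g i * (√((i + 1 : ℕ) : ℝ) - √i) := by
  have key : ∀ m ≤ n, ‖∑ i ∈ Finset.range m, g i • c i - g m • ∑ i ∈ Finset.range m, c i‖ ≤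
      D * (∑ i ∈ Finset.range m, g i * (√((i + 1 : ℕ) : ℝ) - √i) - g m * √m) := by
    intro m
    induction m with
    | zero => simp
    | succ m ih =>
      intro hm
      have ih := ih (by omega)
      have hd : 0 ≤ g m - g (m + 1) := sub_nonneg.mpr (hg (Nat.le_succ m))
      have h1 : ∑ i ∈ Finset.range (m + 1), g i • c i
            - g (m + 1) • ∑ i ∈ Finset.range (m + 1), c i =
          (∑ i ∈ Finset.range m, g i • c i - g m • ∑ i ∈ Finset.range m, c i)
            + (g m - g (m + 1)) • ∑ i ∈ Finset.range (m + 1), c i := by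
        simp only [Finset.sum_range_succ]
        module
      rw [h1]
      refine (norm_add_le _ _).trans ?_
      rw [norm_smul, Real.norm_of_nonneg hd]
      have h2 := mul_le_mul_of_nonneg_left (hP (m + 1) hm) hd
      rw [Finset.sum_range_succ (fun i => g i * (√((i + 1 : ℕ) : ℝ) - √i))]
      linarith
  simpa [hgn] using key n le_rfl

theorem sqrt_succ_sub_sqrt_sq_le (i : ℕ) :
    (√((i + 1 : ℕ) : ℝ) - √i) ^ 2 ≤ ((i + 1 : ℕ) : ℝ)⁻¹ := by
  have h1 : √((i + 1 : ℕ) : ℝ) ^ 2 = (i : ℝ) + 1 := by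
    rw [Real.sq_sqrt (by positivity)]; push_cast; rfl
  have h2 : √(i : ℝ) ^ 2 = i := Real.sq_sqrt (by positivity)
  set a := √((i + 1 : ℕ) : ℝ)
  set b := √(i : ℝ)
  have ha : 0 < a := Real.sqrt_pos.mpr (by positivity)
  have hb : 0 ≤ b := Real.sqrt_nonneg _
  have hab : (a - b) * (a + b) = 1 := by nlinarith
  have hle : b ≤ a := Real.sqrt_le_sqrt (by push_cast; linarith)
  have h3 : (a - b) * a ≤ 1 := by nlinarith
  have h4 : 0 ≤ (a - b) * a := mul_nonneg (sub_nonneg.mpr hle) ha.le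
  push_cast
  rw [← h1, ← one_div, le_div_iff₀ (by positivity)]
  nlinarith

theorem sum_sqrt_succ_sub_sqrt_sq_le (n : ℕ) :
    ∑ i ∈ Finset.range n, (√((i + 1 : ℕ) : ℝ) - √i) ^ 2 ≤ Real.log n + 1 := by
  refine (Finset.sum_le_sum fun i _ => sqrt_succ_sub_sqrt_sq_le i).trans ?_
  have := harmonic_le_one_add_log n
  rw [harmonic] at this
  push_cast at this ⊢
  linarith

theorem norm_sum_smul_le_of_finset {ι E : Type*} [Fintype ι] [NormedAddCommGroup E]
    [NormedSpace ℝ E] (a : ι → E) {D : ℝ} (hD : 0 ≤ D)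
    (ha : ∀ X : Finset ι, ‖∑ x ∈ X, a x‖ ≤ D * √X.card) {f : ι → ℝ} (hf : ∀ x, 0 ≤ f x) :
    ‖∑ x, f x • a x‖ ≤
      D * (√(∑ x, f x ^ 2) * √(Real.log (Fintype.card ι) + 1)) := by
  set n := Fintype.card ι
  let e := (Fintype.equivFin ι).symm
  let σ : Fin n ≃ ι := (sortDesc (f ∘ e)).trans e
  have hanti : Antitone (f ∘ σ) := antitone_comp_sortDesc (f ∘ e)
  set g := extendByZero (f ∘ σ)
  set c := extendByZero (a ∘ σ)
  have hP : ∀ m ≤ n, ‖∑ i ∈ Finset.range m, c i‖ ≤ D * √m := by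
    intro m hm
    obtain ⟨Y, hY, h⟩ := exists_finset_sum_range_extendByZero hm σ
    rw [h a, ← hY]
    exact ha Y
  have hsum : ∑ i ∈ Finset.range n, g i • c i = ∑ x, f x • a x := by
    rw [Finset.sum_range, ← σ.sum_comp]
    refine Finset.sum_congr rfl fun i _ => ?_
    simp only [g, c, extendByZero_of_lt _ i.2]
    rfl
  have hsq : ∑ i ∈ Finset.range n, g i ^ 2 = ∑ x, f x ^ 2 := by
    rw [Finset.sum_range, ← σ.sum_comp]
    refine Finset.sum_congr rfl fun i _ => ?_
    simp only [g, extendByZero_of_lt _ i.2]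
    rfl
  have h1 := norm_sum_smul_le_of_prefix
    (antitone_extendByZero (fun i => hf (σ i)) hanti) hP (extendByZero_of_le _ le_rfl)
  rw [← hsum, ← hsq]
  refine h1.trans (mul_le_mul_of_nonneg_left ?_ hD)
  refine (Real.sum_mul_le_sqrt_mul_sqrt _ _ _).trans ?_
  exact mul_le_mul_of_nonneg_left (Real.sqrt_le_sqrt (sum_sqrt_succ_sub_sqrt_sq_le n))
    (Real.sqrt_nonneg _)

theorem one_le_rho_and_sum_sq_le {n : ℕ} (hn : 0 < n) (d : Fin n → ℝ) (hd : ∀ i, 0 ≤ d i) :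
    1 ≤ rho d ∧ ∀ C : ℝ, (∀ Y : Finset (Fin n), ∑ i ∈ Y, d i ≤ C * √Y.card) →
      ∑ i, d i ^ 2 ≤ 2 * (C ^ 2 * (Real.log (rho d) + 1)) := by
  classical
  set s : Fin n → ℝ := fun i => d (Tuple.sort d i.rev) with hs
  have hs_anti : Antitone s := antitone_comp_sortDesc d
  have hs0 : ∀ i, 0 ≤ s i := fun i => hd _
  set S : Set ℕ := {k : ℕ |
        ∑ i : Fin n, (if k < (i : ℕ) then s i ^ 2 else 0) ≤
        ∑ i : Fin n, (if (i : ℕ) ≤ k then s i ^ 2 else 0)} with hS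
  have hmem : n - 1 ∈ S := by
    rw [hS, Set.mem_ofPred_eq]
    refine Finset.sum_le_sum fun i _ => ?_
    rw [if_neg (by omega)]
    split_ifs <;> positivity
  have hk_le : sInf S ≤ n - 1 := Nat.sInf_le hmem
  have hkS : sInf S ∈ S := Nat.sInf_mem ⟨_, hmem⟩
  have hkn : sInf S < n := by omega
  have hrho : rho d = if s ⟨sInf S, hkn⟩ ≠ 0 then s ⟨0, hn⟩ / s ⟨sInf S, hkn⟩ else 1 := by
    have hkeq : (⟨min (sInf S) (n - 1), lt_of_le_of_lt (min_le_right _ _)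
        (Nat.sub_lt hn one_pos)⟩ : Fin n) = ⟨sInf S, hkn⟩ := Fin.ext (min_eq_left hk_le)
    rw [← hkeq, rho, dif_pos hn]
  set k := sInf S with hk
  have htot : ∑ i, d i ^ 2 = ∑ i, s i ^ 2 :=
    (Equiv.sum_comp (sortDesc d) fun i => d i ^ 2).symm
  have hsplit : ∀ j : ℕ, ∑ i, s i ^ 2 =
      ∑ i : Fin n, (if (i : ℕ) ≤ j then s i ^ 2 else 0) +
      ∑ i : Fin n, (if j < (i : ℕ) then s i ^ 2 else 0) := by
    intro j
    rw [← Finset.sum_add_distrib]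
    refine Finset.sum_congr rfl fun i _ => ?_
    by_cases h : (i : ℕ) ≤ j
    · rw [if_pos h, if_neg (by omega), add_zero]
    · rw [if_neg h, if_pos (by omega), zero_add]
  have hhalf : ∑ i, s i ^ 2 ≤ 2 * ∑ i : Fin n, (if (i : ℕ) ≤ k then s i ^ 2 else 0) := by
    rw [hS, Set.mem_ofPred_eq] at hkS
    rw [hsplit k]
    linarith
  by_cases h0 : s ⟨k, hkn⟩ = 0
  · rw [hrho, if_neg (not_not.mpr h0)]
    refine ⟨le_rfl, fun C _ => ?_⟩
    have htail : ∀ i : Fin n, k ≤ i → s i = 0 := fun i hi =>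
      le_antisymm (h0 ▸ hs_anti (show (⟨k, hkn⟩ : Fin n) ≤ i from hi)) (hs0 i)
    have hk0 : k = 0 := by
      by_contra hk0
      have hlt : k - 1 < sInf S := by omega
      refine Nat.notMem_of_lt_sInf hlt ?_
      rw [hS, Set.mem_ofPred_eq]
      refine Finset.sum_le_sum fun i _ => ?_
      by_cases hi : k - 1 < i
      · rw [if_pos hi, htail i (by omega)]
        split_ifs <;> simp
      · rw [if_neg hi]
        split_ifs <;> positivity
    have : ∑ i, s i ^ 2 = 0 :=
      Finset.sum_eq_zero fun i _ => by rw [htail i (by omega)]; simp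
    rw [htot, this]
    simp only [Real.log_one]
    positivity
  · have hpos : 0 < s ⟨k, hkn⟩ := lt_of_le_of_ne (hs0 _) (Ne.symm h0)
    rw [hrho, if_pos h0]
    refine ⟨(one_le_div hpos).mpr (hs_anti (show (⟨0, hn⟩ : Fin n) ≤ ⟨k, hkn⟩ from Nat.zero_le k)), fun C hC => ?_⟩
    have hpre : ∀ m ≤ n, ∑ i ∈ Finset.range m, extendByZero s i ≤ C * √m := by
      intro m hm
      obtain ⟨Y, hY, h⟩ := exists_finset_sum_range_extendByZero hm (sortDesc d)
      exact ((h d).trans_le (hC Y)).trans_eq (by rw [hY])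
    have h1 := sum_sq_le_of_prefix_sum_le (antitone_extendByZero hs0 hs_anti) hpre hkn
      (by rwa [extendByZero_of_lt s hkn])
    rw [extendByZero_of_lt s hn, extendByZero_of_lt s hkn] at h1
    have h2 : ∑ i : Fin n, (if (i : ℕ) ≤ k then s i ^ 2 else 0) =
        ∑ i ∈ Finset.range (k + 1), extendByZero s i ^ 2 := by
      have h3 : ∀ i : Fin n, (if (i : ℕ) ≤ k then s i ^ 2 else 0) =
          if (i : ℕ) ≤ k then extendByZero s i ^ 2 else 0 := fun i => by
        rw [extendByZero_of_lt s i.2]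
      rw [Finset.sum_congr rfl fun i _ => h3 i,
        Fin.sum_univ_eq_sum_range (fun i => if i ≤ k then extendByZero s i ^ 2 else 0) n,
        ← Finset.sum_filter]
      refine Finset.sum_congr ?_ fun _ _ => rfl
      ext i
      simp only [Finset.mem_filter, Finset.mem_range]
      omega
    rw [htot]
    linarith

open Matrix in
open Classical in
theorem exists_mulVec_eq_lamMax_smul {V : Type*} [Fintype V] [Nonempty V] (G : SimpleGraph V) :
    ∃ x : V → ℝ, x ≠ 0 ∧ G.adjMatrix ℝ *ᵥ x = lamMax G • x := by
  have hA : (G.adjMatrix ℝ).IsHermitian := G.isSymm_adjMatrix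
  have hmem : lamMax G ∈ spectrum ℝ (G.adjMatrix ℝ) := by
    refine Set.Nonempty.csSup_mem ?_ ?_ <;> rw [hA.spectrum_real_eq_range_eigenvalues]
    exacts [Set.range_nonempty _, Set.finite_range _]
  rw [hA.spectrum_real_eq_range_eigenvalues] at hmem
  obtain ⟨j, hj⟩ := hmem
  refine ⟨hA.eigenvectorBasis j, ?_, ?_⟩
  · intro h
    refine hA.eigenvectorBasis.toBasis.ne_zero j ?_
    ext v
    simpa using congrFun h v
  · rw [hA.mulVec_eigenvectorBasis, hj]

open Matrix in
open Classical in
theorem dotProduct_adjMatrix_mulVec_le {V : Type*} [Fintype V] (G : SimpleGraph V)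
    (x : V → ℝ) : x ⬝ᵥ G.adjMatrix ℝ *ᵥ x ≤ lamMax G * (x ⬝ᵥ x) := by
  have hA : (G.adjMatrix ℝ).IsHermitian := G.isSymm_adjMatrix
  have hbdd : BddAbove (spectrum ℝ (G.adjMatrix ℝ)) := by
    rw [hA.spectrum_real_eq_range_eigenvalues]
    exact (Set.finite_range _).bddAbove
  have hpsd : (algebraMap ℝ (Matrix V V ℝ) (lamMax G) - G.adjMatrix ℝ).PosSemidef := by
    rw [posSemidef_iff_isHermitian_and_spectrum_nonneg]
    constructor
    · refine IsHermitian.sub ?_ hA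
      rw [algebraMap_eq_diagonal]
      exact isHermitian_diagonal _
    · rw [← spectrum.singleton_sub_eq]
      rintro _ ⟨_, rfl, b, hb, rfl⟩
      exact sub_nonneg.mpr (le_csSup hbdd hb)
  have h := hpsd.dotProduct_mulVec_nonneg x
  rw [sub_mulVec, dotProduct_sub, Algebra.algebraMap_eq_smul_one, smul_mulVec, one_mulVec,
    dotProduct_smul, star_trivial, smul_eq_mul] at h
  linarith

open Matrix in
open Classical in
theorem abs_dotProduct_adjMatrix_mulVec_le {V : Type*} [Fintype V] (G : SimpleGraph V)
    (x : V → ℝ) : |x ⬝ᵥ G.adjMatrix ℝ *ᵥ x| ≤ lamMax G * (x ⬝ᵥ x) := by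
  have h := dotProduct_adjMatrix_mulVec_le G (fun v => |x v|)
  have h1 : (fun v => |x v|) ⬝ᵥ (fun v => |x v|) = x ⬝ᵥ x := by simp [dotProduct]
  rw [h1] at h
  refine le_trans ?_ h
  rw [G.dotProduct_mulVec_adjMatrix, G.dotProduct_mulVec_adjMatrix]
  refine (Finset.abs_sum_le_sum_abs _ _).trans (Finset.sum_le_sum fun i _ => ?_)
  refine (Finset.abs_sum_le_sum_abs _ _).trans (Finset.sum_le_sum fun j _ => ?_)
  split_ifs
  · rw [abs_mul]
  · simp

open Matrix in
open Classical in
theorem dotProduct_adjMatrix_mulVec_le_add {V : Type*} [Fintype V] (G : SimpleGraph V)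
    (x y : V → ℝ) :
    2 * (x ⬝ᵥ G.adjMatrix ℝ *ᵥ y) ≤ lamMax G * (x ⬝ᵥ x + y ⬝ᵥ y) := by
  have h1 := (abs_le.mp (abs_dotProduct_adjMatrix_mulVec_le G (x + y))).2
  have h2 := (abs_le.mp (abs_dotProduct_adjMatrix_mulVec_le G (x - y))).1
  have h3 : y ⬝ᵥ G.adjMatrix ℝ *ᵥ x = x ⬝ᵥ G.adjMatrix ℝ *ᵥ y := by
    rw [dotProduct_mulVec, ← mulVec_transpose, G.transpose_adjMatrix, dotProduct_comm]
  have h4 : y ⬝ᵥ x = x ⬝ᵥ y := dotProduct_comm _ _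
  simp only [mulVec_add, mulVec_sub, dotProduct_add, dotProduct_sub, add_dotProduct,
    sub_dotProduct, h3, h4] at h1 h2
  linarith

open Matrix in
open Classical in
theorem eXY_le_lamMax_mul {V : Type*} [Fintype V] (G : SimpleGraph V) {X Y : Finset V}
    (hX : X.Nonempty) (hY : Y.Nonempty) :
    (eXY G X Y : ℝ) ≤ lamMax G * √((X.card : ℝ) * Y.card) := by
  have hp : 0 < √(X.card : ℝ) := Real.sqrt_pos.mpr (by exact_mod_cast hX.card_pos)
  have hq : 0 < √(Y.card : ℝ) := Real.sqrt_pos.mpr (by exact_mod_cast hY.card_pos)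
  have hp2 : √(X.card : ℝ) ^ 2 = X.card := Real.sq_sqrt (by positivity)
  have hq2 : √(Y.card : ℝ) ^ 2 = Y.card := Real.sq_sqrt (by positivity)
  rw [Real.sqrt_mul (by positivity)]
  set p := √(X.card : ℝ)
  set q := √(Y.card : ℝ)
  have h := dotProduct_adjMatrix_mulVec_le_add G
    (fun v => if v ∈ X then q else 0) (fun v => if v ∈ Y then p else 0)
  rw [G.dotProduct_mulVec_adjMatrix] at h
  have h1 : ∑ i : V, ∑ j : V, (if G.Adj i j then
      (if i ∈ X then q else 0) * (if j ∈ Y then p else 0) else 0) = (p * q) * eXY G X Y := by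
    rw [eXY, Finset.card_filter, Finset.sum_product, Nat.cast_sum, Finset.mul_sum,
      ← Finset.sum_subset (Finset.subset_univ X)]
    · refine Finset.sum_congr rfl fun i hi => ?_
      rw [Nat.cast_sum, Finset.mul_sum, ← Finset.sum_subset (Finset.subset_univ Y)]
      · refine Finset.sum_congr rfl fun j hj => ?_
        simp only [hi, hj, if_true]
        split_ifs <;> simp [mul_comm]
      · intro j _ hj
        simp [hj]
    · intro i _ hi
      simp [hi]
  have h2 : (fun v => if v ∈ X then q else 0) ⬝ᵥ (fun v => if v ∈ X then q else 0) =
      X.card * q ^ 2 := by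
    simp [dotProduct, sq]
  have h3 : (fun v => if v ∈ Y then p else 0) ⬝ᵥ (fun v => if v ∈ Y then p else 0) =
      Y.card * p ^ 2 := by
    simp [dotProduct, sq]
  rw [h1, h2, h3, ← hp2, ← hq2] at h
  have hpq : 0 < p * q := mul_pos hp hq
  refine le_of_mul_le_mul_left ?_ hpq
  linarith

theorem finite_MG_set {V : Type*} [Fintype V] (G : SimpleGraph V) :
    {r : ℝ | ∃ X Y : Finset V, X.Nonempty ∧ Y.Nonempty ∧
      r = (eXY G X Y : ℝ) / √((X.card : ℝ) * (Y.card : ℝ))}.Finite := by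
  refine (Set.finite_range fun p : Finset V × Finset V =>
    (eXY G p.1 p.2 : ℝ) / √((p.1.card : ℝ) * (p.2.card : ℝ))).subset ?_
  rintro _ ⟨X, Y, _, _, rfl⟩
  exact ⟨(X, Y), rfl⟩

theorem MG_nonneg {V : Type*} (G : SimpleGraph V) : 0 ≤ MG G := by
  refine Real.sSup_nonneg ?_
  rintro _ ⟨X, Y, _, _, rfl⟩
  positivity

theorem MG_le_lamMax {V : Type*} [Fintype V] [Nonempty V] (G : SimpleGraph V) :
    MG G ≤ lamMax G := by
  obtain ⟨v⟩ := ‹Nonempty V›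
  refine csSup_le ⟨_, {v}, {v}, by simp, by simp, rfl⟩ ?_
  rintro _ ⟨X, Y, hX, hY, rfl⟩
  have := hX.card_pos
  have := hY.card_pos
  rw [div_le_iff₀ (by positivity)]
  exact eXY_le_lamMax_mul G hX hY

theorem eXY_le_MG_mul {V : Type*} [Fintype V] (G : SimpleGraph V) (X Y : Finset V) :
    (eXY G X Y : ℝ) ≤ MG G * √X.card * √Y.card := by
  rcases X.eq_empty_or_nonempty with rfl | hX
  · simp [eXY]
  rcases Y.eq_empty_or_nonempty with rfl | hY
  · simp [eXY]
  have h : (eXY G X Y : ℝ) / √((X.card : ℝ) * (Y.card : ℝ)) ≤ MG G :=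
    le_csSup (finite_MG_set G).bddAbove ⟨X, Y, hX, hY, rfl⟩
  have := hX.card_pos
  have := hY.card_pos
  rw [div_le_iff₀ (by positivity), Real.sqrt_mul (by positivity)] at h
  linarith

theorem sum_card_filter_adj_eq_eXY {V : Type*} (G : SimpleGraph V)
    [DecidableRel G.Adj] (X Y : Finset V) :
    ∑ v ∈ Y, ((X.filter fun x => G.Adj v x).card : ℝ) = eXY G Y X := by
  classical
  rw [eXY, Finset.card_filter, Finset.sum_product, Nat.cast_sum]
  refine Finset.sum_congr rfl fun v _ => ?_
  rw [Finset.card_filter]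
  congr!

open Matrix in
theorem lamMax_le_of_norm_neighbor_count {V : Type*} [Fintype V] [Nonempty V]
    (G : SimpleGraph V) [DecidableRel G.Adj] {D : ℝ} (hD : 0 ≤ D)
    (h : ∀ X : Finset V, X.Nonempty →
      ∑ v, ((X.filter fun x => G.Adj v x).card : ℝ) ^ 2 ≤ D ^ 2 * X.card) :
    lamMax G ≤ D * √(Real.log (Fintype.card V) + 1) := by
  classical
  obtain ⟨x, hx0, hx⟩ := exists_mulVec_eq_lamMax_smul G
  let a : V → EuclideanSpace ℝ V := fun w => WithLp.toLp 2 fun v => if G.Adj v w then 1 else 0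
  have ha : ∀ X : Finset V, ‖∑ w ∈ X, a w‖ ≤ D * √X.card := by
    intro X
    rcases X.eq_empty_or_nonempty with rfl | hX
    · simp
    refine le_of_sq_le_sq ?_ (by positivity)
    rw [mul_pow, Real.sq_sqrt (by positivity), EuclideanSpace.real_norm_sq_eq]
    refine le_trans (le_of_eq ?_) (h X hX)
    refine Finset.sum_congr rfl fun v _ => ?_
    simp [a]
  have hmain := norm_sum_smul_le_of_finset a hD ha (f := fun v => |x v|) fun v => abs_nonneg _
  have hcoord : ∀ v, (∑ w, |x w| • a w) v = ∑ w, if G.Adj v w then |x w| else 0 := by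
    intro v
    simp [a]
  have hpt : ∀ v, |lamMax G| * |x v| ≤ (∑ w, |x w| • a w) v := by
    intro v
    rw [hcoord, ← abs_mul]
    have : lamMax G * x v = ∑ w, if G.Adj v w then x w else 0 := by
      rw [← smul_eq_mul, ← Pi.smul_apply, ← hx]
      simp only [mulVec, dotProduct, SimpleGraph.adjMatrix_apply, ite_mul, one_mul, zero_mul]
    rw [this]
    refine (Finset.abs_sum_le_sum_abs _ _).trans (Finset.sum_le_sum fun w _ => ?_)
    split_ifs <;> simp
  have hpos : 0 < √(∑ v, |x v| ^ 2) := by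
    refine Real.sqrt_pos.mpr ?_
    obtain ⟨v, hv⟩ := Function.ne_iff.mp hx0
    exact Finset.sum_pos' (fun _ _ => by positivity)
      ⟨v, Finset.mem_univ v, pow_pos (abs_pos.mpr hv) 2⟩
  have hlow : |lamMax G| * √(∑ v, |x v| ^ 2) ≤ ‖∑ w, |x w| • a w‖ := by
    rw [EuclideanSpace.norm_eq]
    refine Real.le_sqrt_of_sq_le ?_
    rw [mul_pow, Real.sq_sqrt (by positivity), Finset.mul_sum]
    refine Finset.sum_le_sum fun v _ => ?_
    rw [← mul_pow, Real.norm_eq_abs]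
    exact pow_le_pow_left₀ (by positivity) ((hpt v).trans (le_abs_self _)) 2
  refine (le_abs_self _).trans (le_of_mul_le_mul_right ?_ hpos)
  linarith

/-- Theorem 3: with `d_X(v)` the number of neighbors of `v` in `X` and
`K = max_{∅ ≠ X ⊆ V} ρ((d_X(v))_{v ∈ V})`, one has
`M(G) ≤ λmax(G) ≤ √(2·(log K + 1)·(log|V| + 4))·M(G)`. -/
theorem statement2 {V : Type*} [Fintype V] [Nonempty V]
    (G : SimpleGraph V) [DecidableRel G.Adj] (K : ℝ)
    (hK : K = sSup {r : ℝ | ∃ X : Finset V, X.Nonempty ∧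
      r = rho (fun i : Fin (Fintype.card V) =>
        ((X.filter fun x => G.Adj ((Fintype.equivFin V).symm i) x).card : ℝ))}) :
    MG G ≤ lamMax G ∧
      lamMax G ≤ Real.sqrt (2 * (Real.log K + 1) *
        (Real.log (Fintype.card V) + 4)) * MG G := by
  refine ⟨MG_le_lamMax G, ?_⟩
  have hn : 0 < Fintype.card V := Fintype.card_pos
  set d : Finset V → Fin (Fintype.card V) → ℝ := fun X i =>
    ((X.filter fun x => G.Adj ((Fintype.equivFin V).symm i) x).card : ℝ) with hd
  have hrho : ∀ X, 1 ≤ rho (d X) ∧ ∀ C : ℝ, (∀ Y, ∑ i ∈ Y, d X i ≤ C * √Y.card) →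
      ∑ i, d X i ^ 2 ≤ 2 * (C ^ 2 * (Real.log (rho (d X)) + 1)) :=
    fun X => one_le_rho_and_sum_sq_le hn (d X) fun i => Nat.cast_nonneg _
  have hbdd : BddAbove {r : ℝ | ∃ X : Finset V, X.Nonempty ∧ r = rho (d X)} := by
    refine ((Set.finite_range fun X : Finset V => rho (d X)).subset ?_).bddAbove
    rintro _ ⟨X, _, rfl⟩
    exact ⟨X, rfl⟩
  have hle : ∀ X : Finset V, X.Nonempty → rho (d X) ≤ K := fun X hX =>
    hK ▸ le_csSup hbdd ⟨X, hX, rfl⟩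
  have hK1 : 1 ≤ K := (hrho Finset.univ).1.trans (hle _ Finset.univ_nonempty)
  have hlogK : 0 ≤ Real.log K := Real.log_nonneg hK1
  have hM := MG_nonneg G
  have hlogn : 0 ≤ Real.log (Fintype.card V) := Real.log_natCast_nonneg _
  have hbound : ∀ X : Finset V, X.Nonempty →
      ∑ v, ((X.filter fun x => G.Adj v x).card : ℝ) ^ 2 ≤
        (MG G * √(2 * (Real.log K + 1))) ^ 2 * X.card := by
    intro X hX
    have hC : ∀ Y, ∑ i ∈ Y, d X i ≤ MG G * √X.card * √Y.card := by
      intro Y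
      have h1 := eXY_le_MG_mul G (Y.map (Fintype.equivFin V).symm.toEmbedding) X
      rw [← sum_card_filter_adj_eq_eXY, Finset.sum_map, Finset.card_map] at h1
      refine h1.trans (le_of_eq ?_)
      ring
    have h2 := (hrho X).2 _ hC
    have h3 : Real.log (rho (d X)) ≤ Real.log K :=
      Real.log_le_log (one_pos.trans_le (hrho X).1) (hle X hX)
    rw [← (Fintype.equivFin V).symm.sum_comp]
    refine h2.trans ?_
    rw [mul_pow, mul_pow, Real.sq_sqrt (by positivity), Real.sq_sqrt (by positivity)]
    calc 2 * (MG G ^ 2 * X.card * (Real.log (rho (d X)) + 1))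
        ≤ 2 * (MG G ^ 2 * X.card * (Real.log K + 1)) := by gcongr
      _ = _ := by ring
  refine (lamMax_le_of_norm_neighbor_count G (by positivity) hbound).trans ?_
  rw [Real.sqrt_mul (by positivity) (Real.log (Fintype.card V) + 4), mul_comm (MG G),
    mul_right_comm]
  gcongr
  norm_num
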